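/- arXiv:1304.2531 — 4 statements merged into one kernel-verified Lean document; each statement's English description precedes it below -/
import Mathlib

section
/- Let p ∈ (2,3] and let a, u ∈ ℝ^d (with the Euclidean norm |·| and inner product ⟨·,·⟩). Then |a + u|^p ≤ |a|^p + p·|a|^{p−2}⟨a,u⟩ + (p(p+1)/2)·(|a|^{p−2}|u|² + |u|^p). -/
open scoped RealInnerProductSpace

lemma aux_real (q A U N s : ℝ) (hq0 : 0 < q) (hq1 : q ≤ 1) (hA : 0 ≤ A) (hU : 0 ≤ U)
    (hN : 0 ≤ N) (hs : |s| ≤ A * U) (hNN : N ^ 2 = A ^ 2 + 2 * s + U ^ 2) (hNle : N ≤ A + U) :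
    N ^ q * N ^ 2 ≤ A ^ q * A ^ 2 + (q + 2) * A ^ q * s
      + (q + 2) * (q + 3) / 2 * (A ^ q * U ^ 2 + U ^ q * U ^ 2) := by
  have hAq : 0 ≤ A ^ q := Real.rpow_nonneg hA q
  have hUq : 0 ≤ U ^ q := Real.rpow_nonneg hU q
  obtain ⟨hs1, hs2⟩ := abs_le.mp hs
  rcases le_or_gt U A with h | h
  · rcases hA.eq_or_lt with h0 | hApos
    · subst h0
      have hU0 : U = 0 := le_antisymm h hU
      subst hU0
      have hN0 : N = 0 := le_antisymm (by linarith) hN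
      subst hN0
      have : s = 0 := by linarith
      subst this
      simp
    · set y := (2 * s + U ^ 2) / A ^ 2 with hy
      have hyA : y * A ^ 2 = 2 * s + U ^ 2 := by rw [hy]; field_simp
      have hNA : (N / A) ^ 2 = 1 + y := by
        rw [div_pow, hNN, hy]; field_simp; ring
      have hNq : N ^ q = A ^ q * (1 + y) ^ (q / 2) := by
        rw [← hNA, ← Real.rpow_natCast, ← Real.rpow_mul (by positivity)]
        push_cast
        rw [show (2 : ℝ) * (q / 2) = q by ring]
        rw [← Real.mul_rpow hA (by positivity)]
        congr 1
        field_simp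
      have hy1 : -1 ≤ y := by nlinarith [sq_nonneg (N / A)]
      have hb : (1 + y) ^ (q / 2) ≤ 1 + q / 2 * y :=
        rpow_one_add_le_one_add_mul_self hy1 (by linarith) (by linarith)
      have h1 : N ^ q * N ^ 2 ≤ A ^ q * (1 + q / 2 * y) * N ^ 2 := by
        rw [hNq]; gcongr
      have hyt : |2 * s + U ^ 2| ≤ 3 * (A * U) := by
        rw [abs_le]; constructor <;> nlinarith
      have ht2 : (y * A ^ 2) ^ 2 ≤ (3 * (A * U)) ^ 2 := by
        rw [hyA]; exact sq_le_sq' (abs_le.mp hyt).1 (abs_le.mp hyt).2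
      have hy2 : y ^ 2 * A ^ 2 ≤ 9 * U ^ 2 := by
        have hA2 : 0 < A ^ 2 := by positivity
        refine le_of_mul_le_mul_right ?_ hA2
        nlinarith
      have h2 : (1 + q / 2 * y) * N ^ 2 ≤ A ^ 2 + (q + 2) * s
          + (q + 2) * (q + 3) / 2 * U ^ 2 := by
        have e : (1 + q / 2 * y) * N ^ 2 = A ^ 2 + (q + 2) / 2 * (y * A ^ 2)
            + q / 2 * (y ^ 2 * A ^ 2) := by
          rw [show N ^ 2 = A ^ 2 + y * A ^ 2 by rw [hyA, hNN]; ring]; ring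
        rw [e, hyA]
        have h3 : q / 2 * (y ^ 2 * A ^ 2) ≤ q / 2 * (9 * U ^ 2) := by gcongr
        have h4 : 0 ≤ (1 - q) * (4 - q) * U ^ 2 :=
          mul_nonneg (mul_nonneg (by linarith) (by linarith)) (sq_nonneg U)
        nlinarith
      have h5 := mul_le_mul_of_nonneg_left h2 hAq
      have h6 : 0 ≤ (q + 2) * (q + 3) / 2 * (U ^ q * U ^ 2) := by positivity
      nlinarith
  · have hsub : N ^ q ≤ A ^ q + U ^ q :=
      (Real.rpow_le_rpow hN hNle hq0.le).trans (Real.rpow_add_le_add_rpow hA hU hq0.le hq1)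
    have hle : A ^ q ≤ U ^ q := Real.rpow_le_rpow hA h.le hq0.le
    have hmix : A * U ^ q ≤ A ^ q * U := by
      have e1 : ∀ x : ℝ, 0 ≤ x → x ^ q * x ^ (1 - q) = x := fun x hx => by
        rw [← Real.rpow_add_of_nonneg hx hq0.le (by linarith)]; simp
      have h7 : A ^ (1 - q) ≤ U ^ (1 - q) := Real.rpow_le_rpow hA h.le (by linarith)
      calc A * U ^ q = A ^ q * U ^ q * A ^ (1 - q) := by
            nth_rewrite 1 [← e1 A hA]; ring
        _ ≤ A ^ q * U ^ q * U ^ (1 - q) := by gcongr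
        _ = A ^ q * U := by rw [mul_assoc, e1 U hU]
    have h1 : N ^ q * N ^ 2 ≤ (A ^ q + U ^ q) * N ^ 2 := by gcongr
    rw [hNN] at h1 ⊢
    have h2 : s * (2 * U ^ q - q * A ^ q) ≤ (A * U) * (2 * U ^ q - q * A ^ q) := by
      apply mul_le_mul_of_nonneg_right hs2
      nlinarith
    have h3 : 0 ≤ A * U * (q * A ^ q) := by positivity
    have h4 : A * U ^ q * U ≤ A ^ q * U * U := by gcongr
    have h5 : U ^ q * A ^ 2 ≤ U ^ q * U ^ 2 := by gcongr
    have h6 : 3 * (A ^ q * U ^ 2 + U ^ q * U ^ 2) ≤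
        (q + 2) * (q + 3) / 2 * (A ^ q * U ^ 2 + U ^ q * U ^ 2) := by
      gcongr; nlinarith
    have h7 : 0 ≤ U ^ q * U ^ 2 := by positivity
    nlinarith

/-- For `p ∈ (2,3]` and `a, u ∈ ℝ^d` (Euclidean norm and inner product),
`|a + u|^p ≤ |a|^p + p·|a|^{p−2}⟨a,u⟩ + (p(p+1)/2)·(|a|^{p−2}|u|² + |u|^p)`. -/
theorem statement0 {d : ℕ} (p : ℝ) (hp2 : 2 < p) (hp3 : p ≤ 3)
    (a u : EuclideanSpace ℝ (Fin d)) :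
    ‖a + u‖ ^ p ≤ ‖a‖ ^ p + p * ‖a‖ ^ (p - 2) * ⟪a, u⟫
      + p * (p + 1) / 2 * (‖a‖ ^ (p - 2) * ‖u‖ ^ (2 : ℕ) + ‖u‖ ^ p) := by
  have key := aux_real (p - 2) ‖a‖ ‖u‖ ‖a + u‖ ⟪a, u⟫ (by linarith) (by linarith)
    (norm_nonneg _) (norm_nonneg _) (norm_nonneg _) (abs_real_inner_le_norm a u)
    (norm_add_sq_real a u) (norm_add_le a u)
  have e : ∀ x : ℝ, 0 ≤ x → x ^ p = x ^ (p - 2) * x ^ 2 := fun x hx => by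
    rw [← Real.rpow_natCast x 2, ← Real.rpow_add_of_nonneg hx (by linarith) (by norm_num)]
    congr 1; push_cast; ring
  rw [e _ (norm_nonneg (a + u)), e _ (norm_nonneg a), e _ (norm_nonneg u)]
  rw [show p - 2 + 2 = p by ring, show p - 2 + 3 = p + 1 by ring] at key
  exact key
end

section
/- Let d ≥ 1 be an integer, n ≥ 0, let a_0,…,a_n be nonnegative reals not all zero, and let N > 0. Then for all positive reals N_0,…,N_n with Σ_{ℓ=0}^{n} N_ℓ = N, one has Σ_{ℓ=0}^{n} a_ℓ·N_ℓ^{−1/d} ≥ N^{−1/d}·(Σ_{ℓ=0}^{n} a_ℓ^{d/(d+1)})^{(d+1)/d}, and if all a_ℓ > 0 equality holds for the optimal dispatching N_ℓ = a_ℓ^{d/(d+1)}·N / Σ_{k=0}^{n} a_k^{d/(d+1)}. -/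
/-- Optimal dispatching of grid sizes: for nonnegative `a_0,…,a_n` not all
zero and any positive `N_0,…,N_n` with `Σ N_ℓ = N`,
`Σ a_ℓ N_ℓ^{−1/d} ≥ N^{−1/d} (Σ a_ℓ^{d/(d+1)})^{(d+1)/d}`, with equality (for positive `a_ℓ`)
at the optimal allocation `N_ℓ = a_ℓ^{d/(d+1)} N / Σ_k a_k^{d/(d+1)}`. -/
theorem statement7 (d : ℕ) (hd : 1 ≤ d) (n : ℕ) (a : ℕ → ℝ)
    (ha : ∀ ℓ ≤ n, 0 ≤ a ℓ) (hane : ∃ ℓ ≤ n, a ℓ ≠ 0)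
    (N : ℝ) (hN : 0 < N) :
    (∀ Nl : ℕ → ℝ, (∀ ℓ ≤ n, 0 < Nl ℓ) →
      (∑ ℓ ∈ Finset.range (n + 1), Nl ℓ) = N →
      N ^ (-(1 : ℝ) / d)
          * (∑ ℓ ∈ Finset.range (n + 1), a ℓ ^ ((d : ℝ) / (d + 1))) ^ (((d : ℝ) + 1) / d)
        ≤ ∑ ℓ ∈ Finset.range (n + 1), a ℓ * Nl ℓ ^ (-(1 : ℝ) / d)) ∧
    ((∀ ℓ ≤ n, 0 < a ℓ) →
      (∑ ℓ ∈ Finset.range (n + 1), a ℓ *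
          (a ℓ ^ ((d : ℝ) / (d + 1)) * N
            / ∑ j ∈ Finset.range (n + 1), a j ^ ((d : ℝ) / (d + 1))) ^ (-(1 : ℝ) / d))
        = N ^ (-(1 : ℝ) / d)
          * (∑ ℓ ∈ Finset.range (n + 1), a ℓ ^ ((d : ℝ) / (d + 1))) ^ (((d : ℝ) + 1) / d)) := by
  have hd0 : (0 : ℝ) < d := by exact_mod_cast hd
  have hd1 : (0 : ℝ) < (d : ℝ) + 1 := by linarith
  constructor
  · intro Nl hNl hsum
    have hmem : ∀ i ∈ Finset.range (n + 1), i ≤ n := fun i hi => by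
      have := Finset.mem_range.mp hi
      omega
    have hpq : (((d : ℝ) + 1) / d).HolderConjugate ((d : ℝ) + 1) := by
      rw [Real.holderConjugate_iff]
      constructor
      · rw [lt_div_iff₀ hd0]
        linarith
      · field_simp
    have hb : ∀ i ∈ Finset.range (n + 1), 0 ≤ a i * Nl i ^ (-(1 : ℝ) / d) := fun i hi =>
      mul_nonneg (ha i (hmem i hi)) (Real.rpow_nonneg (hNl i (hmem i hi)).le _)
    have hT := Finset.sum_nonneg hb
    have hS : 0 ≤ ∑ ℓ ∈ Finset.range (n + 1), a ℓ ^ ((d : ℝ) / (d + 1)) :=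
      Finset.sum_nonneg fun i hi => Real.rpow_nonneg (ha i (hmem i hi)) _
    have key := Real.inner_le_Lp_mul_Lq_of_nonneg (Finset.range (n + 1))
      (f := fun i => (a i * Nl i ^ (-(1 : ℝ) / d)) ^ ((d : ℝ) / (d + 1)))
      (g := fun i => Nl i ^ ((1 : ℝ) / (d + 1))) hpq
      (fun i hi => Real.rpow_nonneg (hb i hi) _)
      (fun i hi => Real.rpow_nonneg (hNl i (hmem i hi)).le _)
    have e1 : ∑ i ∈ Finset.range (n + 1), (a i * Nl i ^ (-(1 : ℝ) / d)) ^ ((d : ℝ) / (d + 1))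
        * Nl i ^ ((1 : ℝ) / (d + 1)) = ∑ ℓ ∈ Finset.range (n + 1), a ℓ ^ ((d : ℝ) / (d + 1)) := by
      refine Finset.sum_congr rfl fun i hi => ?_
      have hp := hNl i (hmem i hi)
      rw [Real.mul_rpow (ha i (hmem i hi)) (Real.rpow_nonneg hp.le _), ← Real.rpow_mul hp.le,
        mul_assoc, ← Real.rpow_add hp]
      have : -(1 : ℝ) / d * (d / (d + 1)) + 1 / (d + 1) = 0 := by
        field_simp
        ring
      rw [this, Real.rpow_zero, mul_one]
    have e2 : ∑ i ∈ Finset.range (n + 1),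
        ((a i * Nl i ^ (-(1 : ℝ) / d)) ^ ((d : ℝ) / (d + 1))) ^ (((d : ℝ) + 1) / d)
        = ∑ i ∈ Finset.range (n + 1), a i * Nl i ^ (-(1 : ℝ) / d) := by
      refine Finset.sum_congr rfl fun i hi => ?_
      rw [← Real.rpow_mul (hb i hi)]
      have : (d : ℝ) / (d + 1) * ((d + 1) / d) = 1 := by field_simp
      rw [this, Real.rpow_one]
    have e3 : ∑ i ∈ Finset.range (n + 1), (Nl i ^ ((1 : ℝ) / (d + 1))) ^ ((d : ℝ) + 1) = N := by
      rw [← hsum]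
      refine Finset.sum_congr rfl fun i hi => ?_
      rw [← Real.rpow_mul (hNl i (hmem i hi)).le]
      have : (1 : ℝ) / (d + 1) * (d + 1) = 1 := by field_simp
      rw [this, Real.rpow_one]
    rw [e1, e2, e3] at key
    generalize (∑ i ∈ Finset.range (n + 1), a i * Nl i ^ (-(1 : ℝ) / d)) = T at *
    generalize (∑ ℓ ∈ Finset.range (n + 1), a ℓ ^ ((d : ℝ) / (d + 1))) = S at *
    have k2 := Real.rpow_le_rpow hS key (z := ((d : ℝ) + 1) / d) (by positivity)
    rw [Real.mul_rpow (Real.rpow_nonneg hT _) (Real.rpow_nonneg hN.le _), ← Real.rpow_mul hT,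
      ← Real.rpow_mul hN.le] at k2
    have h1 : 1 / (((d : ℝ) + 1) / d) * ((d + 1) / d) = 1 := by field_simp
    have h2 : 1 / ((d : ℝ) + 1) * ((d + 1) / d) = 1 / d := by field_simp
    rw [h1, h2, Real.rpow_one] at k2
    calc N ^ (-(1 : ℝ) / d) * S ^ (((d : ℝ) + 1) / d)
        ≤ N ^ (-(1 : ℝ) / d) * (T * N ^ ((1 : ℝ) / d)) :=
          mul_le_mul_of_nonneg_left k2 (Real.rpow_nonneg hN.le _)
      _ = T * (N ^ (-(1 : ℝ) / d) * N ^ ((1 : ℝ) / d)) := by ring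
      _ = T := by
          rw [← Real.rpow_add hN, neg_div, neg_add_cancel, Real.rpow_zero, mul_one]
  · intro hpos
    have hpos' : ∀ i ∈ Finset.range (n + 1), 0 < a i := fun i hi => hpos i (by
      have := Finset.mem_range.mp hi
      omega)
    have hS : 0 < ∑ ℓ ∈ Finset.range (n + 1), a ℓ ^ ((d : ℝ) / (d + 1)) :=
      Finset.sum_pos (fun i hi => Real.rpow_pos_of_pos (hpos' i hi) _) ⟨0, by simp⟩
    have hexp : ((d : ℝ) + 1) / d = 1 + 1 / d := by field_simp
    rw [hexp, Real.rpow_add hS, Real.rpow_one, ← mul_assoc, mul_comm (N ^ _), mul_assoc]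
    rw [Finset.sum_mul]
    refine Finset.sum_congr rfl fun i hi => ?_
    have hi0 := hpos' i hi
    generalize (∑ ℓ ∈ Finset.range (n + 1), a ℓ ^ ((d : ℝ) / (d + 1))) = S at *
    have hr := Real.rpow_pos_of_pos hi0 ((d : ℝ) / (d + 1))
    rw [Real.div_rpow (mul_pos hr hN).le hS.le, Real.mul_rpow hr.le hN.le, ← Real.rpow_mul hi0.le,
      neg_div, Real.rpow_neg hS.le, div_inv_eq_mul, ← mul_assoc, ← mul_assoc, ← mul_assoc]
    congr 2
    nth_rewrite 1 [← Real.rpow_one (a i)]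
    rw [← Real.rpow_add hi0]
    congr 1
    field_simp
    ring
end

section
/- Let μ be a probability measure on ℝ^d with finite second moment, let N ≥ 1, and define the quadratic distortion D : (ℝ^d)^N → ℝ by D(y_1,…,y_N) = ∫ min_{1≤i≤N} |ξ − y_i|² dμ(ξ). Let Γ = (x_1,…,x_N) have pairwise distinct components and suppose μ(∪_{i} ∂C_i(Γ)) = 0, where C_i(Γ) = {ξ ∈ ℝ^d : |ξ − x_i| ≤ |ξ − x_j| for all j} are the Voronoi cells of Γ and ∂C_i(Γ) their topological boundaries. Then D is differentiable at Γ and its partial gradient with respect to x_i equals 2·∫_{C_i(Γ)} (x_i − ξ) dμ(ξ) for each i = 1,…,N. -/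
open MeasureTheory

noncomputable section

lemma aux_tie {E : Type*} [NormedAddCommGroup E] [InnerProductSpace ℝ E] (a b ξ : E)
    (hab : a ≠ b) (s : Set E) (hs : ∀ x ∈ s, ‖x - a‖ ≤ ‖x - b‖)
    (hξ : ‖ξ - a‖ = ‖ξ - b‖) : ξ ∉ interior s := by
  intro hint
  have hnhds : s ∈ nhds ξ := mem_interior_iff_mem_nhds.1 hint
  have hcont : Filter.Tendsto (fun t : ℝ => ξ + t • (b - a)) (nhdsWithin 0 (Set.Ioi 0))
      (nhds ξ) := by
    have : Continuous (fun t : ℝ => ξ + t • (b - a)) := by fun_prop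
    have h2 := this.tendsto 0
    simp only [zero_smul, add_zero] at h2
    exact h2.mono_left nhdsWithin_le_nhds
  obtain ⟨t, ht, htpos⟩ := ((hcont.eventually hnhds).and self_mem_nhdsWithin).exists
  have h1 := hs _ ht
  have htpos : 0 < t := htpos
  have h2 : ‖ξ + t • (b - a) - a‖ ^ 2 ≤ ‖ξ + t • (b - a) - b‖ ^ 2 := by gcongr
  have h3 : ‖ξ - a‖ ^ 2 = ‖ξ - b‖ ^ 2 := by rw [hξ]
  have e1 : ξ + t • (b - a) - a = (ξ - a) + t • (b - a) := by abel
  have e2 : ξ + t • (b - a) - b = (ξ - b) + t • (b - a) := by abel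
  rw [e1, e2, norm_add_sq_real, norm_add_sq_real, inner_smul_right, inner_smul_right] at h2
  have h4 : inner ℝ (ξ - a) (b - a) - inner ℝ (ξ - b) (b - a) = ‖b - a‖ ^ 2 := by
    rw [← inner_sub_left, ← real_inner_self_eq_norm_sq]
    congr 1
    abel
  have h5 : 0 < ‖b - a‖ ^ 2 := by
    have : 0 < ‖b - a‖ := norm_pos_iff.2 (sub_ne_zero.2 hab.symm)
    positivity
  nlinarith [mul_pos htpos h5]

lemma aux_iInf_sub {ι : Type*} [Finite ι] [Nonempty ι] (a b : ι → ℝ) (c : ℝ)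
    (h : ∀ i, a i ≤ b i + c) : (⨅ i, a i) ≤ (⨅ i, b i) + c := by
  obtain ⟨i, hi⟩ := exists_eq_ciInf_of_finite (f := b)
  rw [← hi]
  exact (ciInf_le (Set.finite_range a).bddBelow i).trans (h i)

/-- Differentiability of the quadratic distortion
`D(y_1,…,y_N) = ∫ min_i |ξ − y_i|² dμ(ξ)` at an `N`-tuple `Γ` with pairwise distinct
components whose Voronoi-cell boundaries are `μ`-null; the partial gradient w.r.t. `x_i`
is `2 ∫_{C_i(Γ)} (x_i − ξ) dμ(ξ)`. -/
theorem statement15 {d : ℕ} (N : ℕ) (hN : 0 < N)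
    (μ : Measure (EuclideanSpace ℝ (Fin d))) [IsProbabilityMeasure μ]
    (hmom : Integrable (fun ξ => ‖ξ‖ ^ 2) μ)
    (Γ : Fin N → EuclideanSpace ℝ (Fin d)) (hΓ : Function.Injective Γ)
    (C : Fin N → Set (EuclideanSpace ℝ (Fin d)))
    (hC : ∀ i, C i = {ξ | ∀ j, ‖ξ - Γ i‖ ≤ ‖ξ - Γ j‖})
    (hbd : μ (⋃ i, frontier (C i)) = 0) :
    HasFDerivAt
      (fun Y : Fin N → EuclideanSpace ℝ (Fin d) => ∫ ξ, (⨅ i, ‖ξ - Y i‖ ^ 2) ∂μ)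
      (∑ i : Fin N, (2 : ℝ) •
        ((innerSL ℝ (∫ ξ in C i, (Γ i - ξ) ∂μ)).comp
          (ContinuousLinearMap.proj (R := ℝ)
            (φ := fun _ : Fin N => EuclideanSpace ℝ (Fin d)) i)))
      Γ := by
  have : Nonempty (Fin N) := ⟨⟨0, hN⟩⟩
  have hclosed : ∀ i, IsClosed (C i) := by
    intro i
    rw [hC i, Set.ofPred_forall]
    exact isClosed_iInter fun j => isClosed_le (by fun_prop) (by fun_prop)
  have hmeasC : ∀ i, MeasurableSet (C i) := fun i => (hclosed i).measurableSet
  have hnorm : Integrable (fun ξ : EuclideanSpace ℝ (Fin d) => ‖ξ‖) μ := by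
    refine Integrable.mono' (hmom.add (integrable_const (1 : ℝ))) (by fun_prop) ?_
    refine Filter.Eventually.of_forall fun ξ => ?_
    simp only [norm_norm, Pi.add_apply]
    nlinarith [sq_nonneg (‖ξ‖ - 1)]
  have hid : Integrable (fun ξ : EuclideanSpace ℝ (Fin d) => ξ) μ :=
    (integrable_norm_iff (by fun_prop)).1 hnorm
  have hFmeas : ∀ Y : Fin N → EuclideanSpace ℝ (Fin d),
      Measurable (fun ξ => ⨅ i, ‖ξ - Y i‖ ^ 2) := by
    intro Y
    exact Measurable.iInf fun i => by fun_prop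
  set G : Fin N → EuclideanSpace ℝ (Fin d) →
      ((Fin N → EuclideanSpace ℝ (Fin d)) →L[ℝ] ℝ) := fun i ξ =>
    (2 : ℝ) • ((innerSL ℝ (Γ i - ξ)).comp
          (ContinuousLinearMap.proj (R := ℝ)
            (φ := fun _ : Fin N => EuclideanSpace ℝ (Fin d)) i)) with hG
  have hGcont : ∀ i, Continuous (G i) := by
    intro i
    have h1 : Continuous fun ξ : EuclideanSpace ℝ (Fin d) => innerSL ℝ (Γ i - ξ) :=
      (innerSL ℝ).continuous.comp (by fun_prop)
    exact (h1.clm_comp continuous_const).const_smul (2 : ℝ)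
  set F' : EuclideanSpace ℝ (Fin d) →
      ((Fin N → EuclideanSpace ℝ (Fin d)) →L[ℝ] ℝ) := fun ξ =>
    ∑ i, (C i).indicator (G i) ξ with hF'
  have hind : ∀ i, AEStronglyMeasurable ((C i).indicator (G i)) μ := fun i =>
    ((hGcont i).aestronglyMeasurable).indicator (hmeasC i)
  have hF'meas : AEStronglyMeasurable F' μ :=
    Finset.aestronglyMeasurable_fun_sum _ fun i _ => hind i
  have hae : ∀ᵐ ξ ∂μ, ξ ∉ ⋃ i, frontier (C i) := measure_eq_zero_iff_ae_notMem.1 hbd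
  have hdiff : ∀ᵐ ξ ∂μ, HasFDerivAt
      (fun Y : Fin N → EuclideanSpace ℝ (Fin d) => ⨅ i, ‖ξ - Y i‖ ^ 2) (F' ξ) Γ := by
    filter_upwards [hae] with ξ hξ
    obtain ⟨i, hi⟩ := Finite.exists_min (fun i => ‖ξ - Γ i‖)
    have hiC : ξ ∈ C i := by rw [hC i]; exact hi
    have hint : ξ ∈ interior (C i) := by
      by_contra hcon
      exact hξ (Set.mem_iUnion.2 ⟨i, subset_closure hiC, hcon⟩)
    have hstrict : ∀ j, j ≠ i → ‖ξ - Γ i‖ < ‖ξ - Γ j‖ := by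
      intro j hj
      refine lt_of_le_of_ne (hi j) fun heq => ?_
      refine aux_tie (Γ i) (Γ j) ξ (fun h => hj (hΓ h).symm) (C i) ?_ heq hint
      intro x hx
      rw [hC i] at hx
      exact hx j
    have hF'ξ : F' ξ = G i ξ := by
      simp only [hF']
      rw [Finset.sum_eq_single i]
      · exact Set.indicator_of_mem hiC _
      · intro j _ hj
        refine Set.indicator_of_notMem (fun hmem => ?_) _
        rw [hC j] at hmem
        exact absurd (hmem i) (not_le.2 (hstrict j hj))
      · simp
    have hev : ∀ᶠ Y : Fin N → EuclideanSpace ℝ (Fin d) in nhds Γ,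
        ∀ j, ‖ξ - Y i‖ ≤ ‖ξ - Y j‖ := by
      rw [Filter.eventually_all]
      intro j
      by_cases hj : j = i
      · subst hj; exact Filter.Eventually.of_forall fun _ => le_rfl
      · have c1 : Continuous fun Y : Fin N → EuclideanSpace ℝ (Fin d) => ‖ξ - Y i‖ := by
          fun_prop
        have c2 : Continuous fun Y : Fin N → EuclideanSpace ℝ (Fin d) => ‖ξ - Y j‖ := by
          fun_prop
        exact ((c1.tendsto Γ).eventually_lt (c2.tendsto Γ) (hstrict j hj)).mono
          fun _ h => h.le
    have heq : (fun Y : Fin N → EuclideanSpace ℝ (Fin d) => ⨅ i, ‖ξ - Y i‖ ^ 2)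
        =ᶠ[nhds Γ] fun Y => ‖ξ - Y i‖ ^ 2 := by
      filter_upwards [hev] with Y hY
      refine le_antisymm (ciInf_le (Set.finite_range _).bddBelow i) (le_ciInf fun j => ?_)
      have := hY j
      gcongr
    refine HasFDerivAt.congr_of_eventuallyEq ?_ heq
    rw [hF'ξ]
    have hp : HasFDerivAt (fun Y : Fin N → EuclideanSpace ℝ (Fin d) => ξ - Y i)
        (-(ContinuousLinearMap.proj (R := ℝ)
            (φ := fun _ : Fin N => EuclideanSpace ℝ (Fin d)) i)) Γ :=
      (ContinuousLinearMap.proj (R := ℝ)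
            (φ := fun _ : Fin N => EuclideanSpace ℝ (Fin d)) i).hasFDerivAt.const_sub ξ
    refine hp.norm_sq.congr_fderiv ?_
    ext v
    simp [hG]
    try ring
  have hFint : Integrable (fun ξ => ⨅ i, ‖ξ - Γ i‖ ^ 2) μ := by
    obtain ⟨i⟩ := this
    refine Integrable.mono' ((hmom.const_mul 2).add (integrable_const (2 * ‖Γ i‖ ^ 2)))
      (hFmeas Γ).aestronglyMeasurable ?_
    refine Filter.Eventually.of_forall fun ξ => ?_
    have h0 : 0 ≤ ⨅ i, ‖ξ - Γ i‖ ^ 2 := Real.iInf_nonneg fun i => by positivity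
    rw [Real.norm_of_nonneg h0]
    refine (ciInf_le (Set.finite_range _).bddBelow i).trans ?_
    simp only [Pi.add_apply]
    have h1 := norm_sub_le ξ (Γ i)
    have h2 : ‖ξ - Γ i‖ ^ 2 ≤ (‖ξ‖ + ‖Γ i‖) ^ 2 := by gcongr
    nlinarith [sq_nonneg (‖ξ‖ - ‖Γ i‖)]
  have hlip : ∀ᵐ ξ ∂μ, ∀ Y ∈ Metric.ball Γ 1,
      ‖(⨅ i, ‖ξ - Y i‖ ^ 2) - ⨅ i, ‖ξ - Γ i‖ ^ 2‖ ≤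
        (2 * ‖ξ‖ + (2 * ‖Γ‖ + 1)) * ‖Y - Γ‖ := by
    refine Filter.Eventually.of_forall fun ξ Y hY => ?_
    rw [Metric.mem_ball, dist_eq_norm] at hY
    have key : ∀ i, |‖ξ - Y i‖ ^ 2 - ‖ξ - Γ i‖ ^ 2| ≤
        (2 * ‖ξ‖ + (2 * ‖Γ‖ + 1)) * ‖Y - Γ‖ := by
      intro i
      have h1 : ‖Y i - Γ i‖ ≤ ‖Y - Γ‖ := norm_le_pi_norm (Y - Γ) i
      have h2 : ‖Γ i‖ ≤ ‖Γ‖ := norm_le_pi_norm Γ i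
      have h3 : ‖ξ - Γ i‖ ≤ ‖ξ‖ + ‖Γ i‖ := norm_sub_le _ _
      have h4 : |‖ξ - Y i‖ - ‖ξ - Γ i‖| ≤ ‖Y i - Γ i‖ := by
        have := abs_norm_sub_norm_le (ξ - Y i) (ξ - Γ i)
        rwa [sub_sub_sub_cancel_left, norm_sub_rev (Γ i)] at this
      have h5 := abs_le.1 h4
      rw [sq_sub_sq, abs_mul, abs_of_nonneg (by positivity)]
      refine mul_le_mul (by linarith [h5.2]) (h4.trans h1) (abs_nonneg _) (by positivity)
    rw [Real.norm_eq_abs, abs_le]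
    have a1 := aux_iInf_sub (fun i => ‖ξ - Y i‖ ^ 2) (fun i => ‖ξ - Γ i‖ ^ 2)
      ((2 * ‖ξ‖ + (2 * ‖Γ‖ + 1)) * ‖Y - Γ‖) (fun i => by linarith [(abs_le.1 (key i)).2])
    have a2 := aux_iInf_sub (fun i => ‖ξ - Γ i‖ ^ 2) (fun i => ‖ξ - Y i‖ ^ 2)
      ((2 * ‖ξ‖ + (2 * ‖Γ‖ + 1)) * ‖Y - Γ‖) (fun i => by linarith [(abs_le.1 (key i)).1])
    constructor <;> linarith
  obtain ⟨hF'int, hmain⟩ := hasFDerivAt_integral_of_dominated_loc_of_lip' (𝕜 := ℝ)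
    (F := fun (Y : Fin N → EuclideanSpace ℝ (Fin d)) ξ => ⨅ i, ‖ξ - Y i‖ ^ 2)
    (Metric.ball_mem_nhds Γ one_pos)
    (fun Y _ => (hFmeas Y).aestronglyMeasurable) hFint hF'meas hlip
    ((hnorm.const_mul 2).add (integrable_const _)) hdiff
  refine hmain.congr_fderiv ?_
  have hsub : ∀ i, Integrable (fun ξ => Γ i - ξ) μ := fun i => (integrable_const _).sub hid
  ext v
  rw [ContinuousLinearMap.integral_apply hF'int]
  have e : ∀ ξ, F' ξ v = ∑ i, (C i).indicator (fun ξ => 2 * inner ℝ (v i) (Γ i - ξ)) ξ := by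
    intro ξ
    simp only [hF', ContinuousLinearMap.sum_apply]
    refine Finset.sum_congr rfl fun i _ => ?_
    by_cases h : ξ ∈ C i
    · rw [Set.indicator_of_mem h, Set.indicator_of_mem h]
      simp [hG]
      rw [inner_sub_right, real_inner_comm (Γ i), real_inner_comm ξ]
    · rw [Set.indicator_of_notMem h, Set.indicator_of_notMem h]
      simp
  simp_rw [e]
  rw [integral_finset_sum _ fun i _ =>
    (((hsub i).const_inner (v i)).const_mul 2).indicator (hmeasC i)]
  rw [ContinuousLinearMap.sum_apply]
  refine Finset.sum_congr rfl fun i _ => ?_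
  rw [integral_indicator (hmeasC i), integral_const_mul,
    integral_inner (hsub i).integrableOn]
  simp only [ContinuousLinearMap.smul_apply, ContinuousLinearMap.comp_apply,
    ContinuousLinearMap.proj_apply, innerSL_apply_apply, smul_eq_mul]
  rw [real_inner_comm]

end
end

section
/- Let μ = Σ_{i=1}^{M} p_i · N(m_i, v_i²) be a finite mixture of real Gaussian distributions with weights p_i ≥ 0, Σp_i = 1, means m_i and standard deviations v_i > 0. Let x_1 < x_2 < … < x_N be reals, set x_{j−1/2} = (x_{j−1}+x_j)/2 for 2 ≤ j ≤ N, x_{1/2} = −∞, x_{N+1/2} = +∞, and define D(x_1,…,x_N) = ∫ min_{1≤j≤N} (ξ − x_j)² dμ(ξ). Then D is differentiable at (x_1,…,x_N) and for each j, ∂D/∂x_j = 2·Σ_{i=1}^{M} p_i · [ (x_j − m_i)·(Φ(β_{ij}) − Φ(α_{ij})) + v_i·(φ(β_{ij}) − φ(α_{ij})) ], where α_{ij} = (x_{j−1/2} − m_i)/v_i, β_{ij} = (x_{j+1/2} − m_i)/v_i, and Φ, φ are the standard normal CDF and density (with the convention Φ(−∞)=0, Φ(+∞)=1, φ(±∞)=0).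 -/
open MeasureTheory ProbabilityTheory

noncomputable section

/-- The standard normal density `φ(t) = (2π)^{−1/2} e^{−t²/2}`. -/
def stdNormalPDF (t : ℝ) : ℝ := (Real.sqrt (2 * Real.pi))⁻¹ * Real.exp (-t ^ 2 / 2)

/-- The standard normal cumulative distribution function `Φ`. -/
def stdNormalCDF (t : ℝ) : ℝ := ∫ u in Set.Iic t, stdNormalPDF u


lemma aux_integrable_pdf : Integrable stdNormalPDF := by
  have h := integrable_exp_neg_mul_sq (b := 1 / 2) (by norm_num)
  have := h.const_mul (Real.sqrt (2 * Real.pi))⁻¹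
  refine this.congr (Filter.Eventually.of_forall fun t => ?_)
  simp only [stdNormalPDF]
  congr 2
  ring

lemma aux_integrable_mul_pdf : Integrable (fun t => t * stdNormalPDF t) := by
  have h := integrable_mul_exp_neg_mul_sq (b := 1 / 2) (by norm_num)
  have := h.const_mul (Real.sqrt (2 * Real.pi))⁻¹
  refine this.congr (Filter.Eventually.of_forall fun t => ?_)
  simp only [stdNormalPDF]
  rw [show -t ^ 2 / 2 = -(1 / 2) * t ^ 2 by ring]
  ring

lemma aux_integral_mul_pdf (s : ℝ) :
    ∫ t in Set.Iic s, t * stdNormalPDF t = - stdNormalPDF s := by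
  have h := integral_Iic_of_hasDerivAt_of_tendsto' (a := s) (m := 0)
    (f := fun t => - stdNormalPDF t) (f' := fun t => t * stdNormalPDF t) ?_
    aux_integrable_mul_pdf.integrableOn ?_
  · simpa using h
  · intro t _
    have h1 : HasDerivAt (fun t : ℝ => -t ^ 2 / 2) (-t) t := by
      have := ((hasDerivAt_pow 2 t).neg).div_const 2
      convert! this using 1
      simp
      ring
    have h2 := (h1.exp.const_mul (Real.sqrt (2 * Real.pi))⁻¹).neg
    convert! h2 using 1
    simp only [stdNormalPDF]
    ring
  · have h1 : Filter.Tendsto (fun t : ℝ => -t ^ 2 / 2) Filter.atBot Filter.atBot := by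
      have : Filter.Tendsto (fun t : ℝ => t ^ 2) Filter.atBot Filter.atTop :=
        Filter.Tendsto.comp (Filter.tendsto_pow_atTop two_ne_zero) Filter.tendsto_abs_atBot_atTop
          |>.congr (fun t => by simp)
      have h3 := (Filter.tendsto_neg_atTop_atBot.comp this).atBot_div_const (r := 2) (by norm_num)
      exact h3
    have h2 := ((Real.tendsto_exp_atBot.comp h1).const_mul (Real.sqrt (2 * Real.pi))⁻¹).neg
    simpa [stdNormalPDF, Function.comp_def] using h2

lemma aux_std (c d s : ℝ) :
    ∫ z in Set.Iic s, (c - d * z) ∂(gaussianReal 0 1) =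
      c * stdNormalCDF s + d * stdNormalPDF s := by
  have hpdf : gaussianPDFReal 0 1 = stdNormalPDF := by
    ext t
    simp [gaussianPDFReal, stdNormalPDF]
  rw [← integral_indicator measurableSet_Iic,
    integral_gaussianReal_eq_integral_smul one_ne_zero, hpdf]
  have : ∀ z, stdNormalPDF z • (Set.Iic s).indicator (fun z => c - d * z) z
      = (Set.Iic s).indicator (fun z => c * stdNormalPDF z - d * (z * stdNormalPDF z)) z := by
    intro z
    by_cases hz : z ∈ Set.Iic s
    · simp only [Set.indicator_of_mem hz, smul_eq_mul]; ring
    · simp only [Set.indicator_of_notMem hz, smul_eq_mul]; ring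
  simp_rw [this]
  rw [integral_indicator measurableSet_Iic, integral_sub, integral_const_mul, integral_const_mul,
    aux_integral_mul_pdf]
  · simp [stdNormalCDF]
  · exact (aux_integrable_pdf.const_mul c).integrableOn
  · exact (aux_integrable_mul_pdf.const_mul d).integrableOn

lemma aux_gauss (a m v t : ℝ) (hv : 0 < v) :
    ∫ ξ in Set.Iic t, (a - ξ) ∂(gaussianReal m (Real.toNNReal (v ^ 2))) =
      (a - m) * stdNormalCDF ((t - m) / v) + v * stdNormalPDF ((t - m) / v) := by
  have hmap : gaussianReal m (Real.toNNReal (v ^ 2))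
      = (gaussianReal 0 1).map (fun z => v * z + m) := by
    have : (fun z : ℝ => v * z + m) = (fun z => z + m) ∘ (fun z => v * z) := rfl
    rw [this, ← Measure.map_map (by fun_prop) (by fun_prop), gaussianReal_map_const_mul,
      gaussianReal_map_add_const]
    congr 1
    · simp
    · ext
      simp [Real.coe_toNNReal _ (sq_nonneg v)]
  rw [hmap, setIntegral_map measurableSet_Iic (by fun_prop) (by fun_prop)]
  have hpre : (fun z : ℝ => v * z + m) ⁻¹' Set.Iic t = Set.Iic ((t - m) / v) := by
    ext z
    simp only [Set.mem_preimage, Set.mem_Iic, le_div_iff₀ hv]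
    constructor <;> intro h <;> linarith
  rw [hpre, ← aux_std]
  congr 1
  ext z
  ring

lemma aux_int_id (m : ℝ) (w : NNReal) : Integrable (fun ξ : ℝ => ξ) (gaussianReal m w) :=
  memLp_one_iff_integrable.1 (memLp_id_gaussianReal 1)

lemma aux_int_sq (m : ℝ) (w : NNReal) : Integrable (fun ξ : ℝ => ξ ^ 2) (gaussianReal m w) :=
  (memLp_id_gaussianReal 2).integrable_sq

lemma aux_gauss_univ (a m : ℝ) (w : NNReal) :
    ∫ ξ, (a - ξ) ∂(gaussianReal m w) = a - m := by
  rw [integral_sub (integrable_const _) (aux_int_id m w)]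
  simp

def aux_U {N : ℕ} (x : Fin N → ℝ) (j : Fin N) : Set ℝ :=
  if h : j.val + 1 < N then Set.Iic ((x j + x ⟨j.val + 1, h⟩) / 2) else Set.univ

def aux_L {N : ℕ} (x : Fin N → ℝ) (j : Fin N) : Set ℝ :=
  if 0 < j.val then
    Set.Iic ((x ⟨j.val - 1, lt_of_le_of_lt (Nat.sub_le _ _) j.isLt⟩ + x j) / 2) else ∅

lemma aux_U_meas {N : ℕ} (x : Fin N → ℝ) (j : Fin N) : MeasurableSet (aux_U x j) := by
  unfold aux_U; split_ifs
  · exact measurableSet_Iic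
  · exact MeasurableSet.univ

lemma aux_L_meas {N : ℕ} (x : Fin N → ℝ) (j : Fin N) : MeasurableSet (aux_L x j) := by
  unfold aux_L; split_ifs
  · exact measurableSet_Iic
  · exact MeasurableSet.empty

lemma aux_L_sub {N : ℕ} (x : Fin N → ℝ) (hx : StrictMono x) (j : Fin N) :
    aux_L x j ⊆ aux_U x j := by
  unfold aux_U aux_L
  split_ifs with h1 h2
  · apply Set.Iic_subset_Iic.2
    have a1 : x ⟨j.val - 1, lt_of_le_of_lt (Nat.sub_le _ _) j.isLt⟩ ≤ x j :=
      hx.monotone (by rw [Fin.le_def]; simp)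
    have a2 : x j ≤ x ⟨j.val + 1, h2⟩ := hx.monotone (by rw [Fin.le_def]; simp)
    linarith
  · exact Set.subset_univ _
  · exact Set.empty_subset _
  · exact Set.subset_univ _

lemma aux_cell_integral {N : ℕ} (x : Fin N → ℝ) (hx : StrictMono x) (j : Fin N)
    (m v : ℝ) (hv : 0 < v) :
    ∫ ξ in aux_U x j \ aux_L x j, (x j - ξ) ∂(gaussianReal m (Real.toNNReal (v ^ 2))) =
      ((x j - m) *
            ((if h : j.val + 1 < N then
                stdNormalCDF (((x j + x ⟨j.val + 1, h⟩) / 2 - m) / v)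
              else 1)
             - (if 0 < j.val then
                stdNormalCDF
                  (((x ⟨j.val - 1, lt_of_le_of_lt (Nat.sub_le _ _) j.isLt⟩ + x j) / 2
                      - m) / v)
              else 0))
           + v *
            ((if h : j.val + 1 < N then
                stdNormalPDF (((x j + x ⟨j.val + 1, h⟩) / 2 - m) / v)
              else 0)
             - (if 0 < j.val then
                stdNormalPDF
                  (((x ⟨j.val - 1, lt_of_le_of_lt (Nat.sub_le _ _) j.isLt⟩ + x j) / 2
                      - m) / v)
              else 0))) := by
  have hI : Integrable (fun ξ => x j - ξ) (gaussianReal m (Real.toNNReal (v ^ 2))) :=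
    (integrable_const _).sub (aux_int_id _ _)
  rw [setIntegral_sdiff (aux_L_meas x j) hI.integrableOn (aux_L_sub x hx j)]
  unfold aux_U aux_L
  split_ifs <;> simp only [aux_gauss _ _ _ _ hv, Measure.restrict_univ, aux_gauss_univ,
    Measure.restrict_empty, integral_zero_measure] <;> ring

lemma aux_lip {N : ℕ} (hN : 0 < N) (Y Z : Fin N → ℝ) (ξ C : ℝ)
    (hC : ∀ j, |(ξ - Y j) ^ 2 - (ξ - Z j) ^ 2| ≤ C) :
    |(⨅ j, (ξ - Y j) ^ 2) - (⨅ j, (ξ - Z j) ^ 2)| ≤ C := by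
  have : Nonempty (Fin N) := ⟨⟨0, hN⟩⟩
  have key : ∀ A B : Fin N → ℝ, (∀ j, A j ≤ B j + C) → (⨅ j, A j) ≤ (⨅ j, B j) + C := by
    intro A B h
    have : (⨅ j, A j) - C ≤ ⨅ j, B j := by
      apply le_ciInf
      intro j
      have := ciInf_le (Set.finite_range A).bddBelow j
      linarith [h j]
    linarith
  rw [abs_le]
  constructor
  · have := key (fun j => (ξ - Z j) ^ 2) (fun j => (ξ - Y j) ^ 2)
      (fun j => by have := abs_le.1 (hC j); linarith)
    linarith
  · have := key (fun j => (ξ - Y j) ^ 2) (fun j => (ξ - Z j) ^ 2)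
      (fun j => by have := abs_le.1 (hC j); linarith)
    linarith

def aux_F' {N : ℕ} (x : Fin N → ℝ) (ξ : ℝ) : (Fin N → ℝ) →L[ℝ] ℝ :=
  ∑ j : Fin N, ((aux_U x j \ aux_L x j).indicator (fun ξ => 2 * (x j - ξ)) ξ) •
    ContinuousLinearMap.proj (R := ℝ) (φ := fun _ : Fin N => ℝ) j

lemma aux_diff {N : ℕ} (hN : 0 < N) (x : Fin N → ℝ) (hx : StrictMono x) (ξ : ℝ)
    (hξ : ∀ j k, j ≠ k → ξ ≠ (x j + x k) / 2) :
    HasFDerivAt (fun Y : Fin N → ℝ => ⨅ j, (ξ - Y j) ^ 2) (aux_F' x ξ) x := by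
  have : Nonempty (Fin N) := ⟨⟨0, hN⟩⟩
  obtain ⟨j, hj⟩ := Finite.exists_min (fun j => (ξ - x j) ^ 2)
  have hlt : ∀ k, k ≠ j → (ξ - x j) ^ 2 < (ξ - x k) ^ 2 := by
    intro k hk
    refine lt_of_le_of_ne (hj k) fun he => ?_
    have h1 : (x k - x j) * (ξ - (x j + x k) / 2) = 0 := by nlinarith
    rcases mul_eq_zero.1 h1 with h | h
    · exact hk (hx.injective (by linarith))
    · exact hξ j k hk.symm (by linarith)
  have hR : ∀ k, j < k → ξ < (x j + x k) / 2 := by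
    intro k hk
    have h1 := hlt k hk.ne'
    have h2 := hx hk
    by_contra! h3
    nlinarith [mul_nonneg (sub_nonneg.2 h2.le) (sub_nonneg.2 h3)]
  have hLf : ∀ k, k < j → (x k + x j) / 2 < ξ := by
    intro k hk
    have h1 := hlt k hk.ne
    have h2 := hx hk
    by_contra! h3
    nlinarith [mul_nonneg (sub_nonneg.2 h2.le) (sub_nonneg.2 h3)]
  have hmem : ξ ∈ aux_U x j \ aux_L x j := by
    constructor
    · unfold aux_U
      split_ifs with h
      · exact (hR _ (by rw [Fin.lt_def]; simp)).le
      · trivial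
    · unfold aux_L
      split_ifs with h
      · simp only [Set.mem_Iic, not_le]
        exact hLf _ (by rw [Fin.lt_def]; simp; omega)
      · simp
  have hnot : ∀ k, k ≠ j → ξ ∉ aux_U x k \ aux_L x k := by
    rintro k hk ⟨hu, hl⟩
    rcases lt_or_gt_of_ne hk with h | h
    · have hk1 : k.val + 1 < N := by have := j.isLt; rw [Fin.lt_def] at h; omega
      rw [aux_U, dif_pos hk1, Set.mem_Iic] at hu
      have h1 := hLf k h
      have h2 : x ⟨k.val + 1, hk1⟩ ≤ x j := hx.monotone (by rw [Fin.lt_def] at h; rw [Fin.le_def]; simpa)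
      linarith
    · have hk1 : 0 < k.val := by rw [Fin.lt_def] at h; omega
      rw [aux_L, if_pos hk1, Set.mem_Iic, not_le] at hl
      have h1 := hR k h
      have h2 : x j ≤ x ⟨k.val - 1, lt_of_le_of_lt (Nat.sub_le _ _) k.isLt⟩ :=
        hx.monotone (by rw [Fin.lt_def] at h; rw [Fin.le_def]; simp; omega)
      linarith
  have hF' : aux_F' x ξ = (2 * (x j - ξ)) •
      ContinuousLinearMap.proj (R := ℝ) (φ := fun _ : Fin N => ℝ) j := by
    unfold aux_F'
    rw [Finset.sum_eq_single j]
    · rw [Set.indicator_of_mem hmem]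
    · intro k _ hk
      rw [Set.indicator_of_notMem (hnot k hk), zero_smul]
    · simp
  rw [hF']
  have hbase : HasFDerivAt (fun Y : Fin N → ℝ => (ξ - Y j) ^ 2) ((2 * (x j - ξ)) •
      ContinuousLinearMap.proj (R := ℝ) (φ := fun _ : Fin N => ℝ) j) x := by
    have h1 : HasFDerivAt (fun Y : Fin N → ℝ => Y j)
      (ContinuousLinearMap.proj (R := ℝ) (φ := fun _ : Fin N => ℝ) j) x := hasFDerivAt_apply j x
    have h2 := (h1.const_sub ξ).pow 2
    convert! h2 using 1
    ext Y
    simp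
    ring
  refine hbase.congr_of_eventuallyEq ?_
  have hev : ∀ᶠ Y in nhds x, ∀ k, k ≠ j → (ξ - Y j) ^ 2 < (ξ - Y k) ^ 2 := by
    rw [Filter.eventually_all]
    intro k
    by_cases hk : k = j
    · simp [hk]
    · have : ∀ᶠ Y : Fin N → ℝ in nhds x, (ξ - Y j) ^ 2 < (ξ - Y k) ^ 2 :=
        ContinuousAt.eventually_lt (((continuous_const.sub (continuous_apply j)).pow 2).continuousAt)
          (((continuous_const.sub (continuous_apply k)).pow 2).continuousAt) (hlt k hk)
      exact this.mono fun Y hY _ => hY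
  filter_upwards [hev] with Y hY
  apply le_antisymm
  · exact ciInf_le (Set.finite_range (fun j => (ξ - Y j) ^ 2)).bddBelow j
  · apply le_ciInf
    intro k
    by_cases hk : k = j
    · rw [hk]
    · exact (hY k hk).le

/-- Closed-form gradient of the quadratic distortion of a finite Gaussian
mixture `μ = Σ_i p_i N(m_i, v_i²)` at a grid `x_1 < … < x_N`:
`∂D/∂x_j = 2 Σ_i p_i [(x_j − m_i)(Φ(β_ij) − Φ(α_ij)) + v_i(φ(β_ij) − φ(α_ij))]`,
with `α_ij = (x_{j−1/2} − m_i)/v_i`, `β_ij = (x_{j+1/2} − m_i)/v_i` and the conventions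
`Φ(−∞) = 0`, `Φ(+∞) = 1`, `φ(±∞) = 0` at the extreme cells. -/
theorem statement17 (M N : ℕ) (hM : 0 < M) (hN : 0 < N)
    (p : Fin M → ℝ) (hp : ∀ i, 0 ≤ p i) (hpsum : ∑ i, p i = 1)
    (m : Fin M → ℝ) (v : Fin M → ℝ) (hv : ∀ i, 0 < v i)
    (μ : Measure ℝ)
    (hμ : μ = ∑ i : Fin M,
      ENNReal.ofReal (p i) • gaussianReal (m i) (Real.toNNReal (v i ^ 2)))
    (x : Fin N → ℝ) (hx : StrictMono x) :
    HasFDerivAt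
      (fun Y : Fin N → ℝ => ∫ ξ, (⨅ j, (ξ - Y j) ^ 2) ∂μ)
      (∑ j : Fin N,
        (2 * ∑ i : Fin M, p i *
          ((x j - m i) *
            ((if h : j.val + 1 < N then
                stdNormalCDF (((x j + x ⟨j.val + 1, h⟩) / 2 - m i) / v i)
              else 1)
             - (if 0 < j.val then
                stdNormalCDF
                  (((x ⟨j.val - 1, lt_of_le_of_lt (Nat.sub_le _ _) j.isLt⟩ + x j) / 2
                      - m i) / v i)
              else 0))
           + v i *
            ((if h : j.val + 1 < N then
                stdNormalPDF (((x j + x ⟨j.val + 1, h⟩) / 2 - m i) / v i)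
              else 0)
             - (if 0 < j.val then
                stdNormalPDF
                  (((x ⟨j.val - 1, lt_of_le_of_lt (Nat.sub_le _ _) j.isLt⟩ + x j) / 2
                      - m i) / v i)
              else 0)))) •
          ContinuousLinearMap.proj (R := ℝ) (φ := fun _ : Fin N => ℝ) j)
      x := by
  have : Nonempty (Fin N) := ⟨⟨0, hN⟩⟩
  have hint : ∀ f : ℝ → ℝ, (∀ i, Integrable f (gaussianReal (m i) (Real.toNNReal (v i ^ 2)))) →
      Integrable f μ := by
    intro f hf
    rw [hμ, integrable_finsetSum_measure]
    intro i _
    exact (hf i).smul_measure ENNReal.ofReal_ne_top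
  have hval : ∀ f : ℝ → ℝ, (∀ i, Integrable f (gaussianReal (m i) (Real.toNNReal (v i ^ 2)))) →
      ∫ ξ, f ξ ∂μ = ∑ i, p i * ∫ ξ, f ξ ∂(gaussianReal (m i) (Real.toNNReal (v i ^ 2))) := by
    intro f hf
    rw [hμ, integral_finsetSum_measure]
    · refine Finset.sum_congr rfl fun i _ => ?_
      rw [integral_smul_measure, ENNReal.toReal_ofReal (hp i), smul_eq_mul]
    · intro i _
      exact (hf i).smul_measure ENNReal.ofReal_ne_top
  have hfin : IsFiniteMeasure μ := by
    have := hint (fun _ => 1) (fun i => integrable_const _)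
    rcases integrable_const_iff.1 this with h | h
    · simp at h
    · exact h
  have hid : Integrable (fun ξ : ℝ => ξ) μ := hint _ fun i => aux_int_id _ _
  have hsq : Integrable (fun ξ : ℝ => ξ ^ 2) μ := hint _ fun i => aux_int_sq _ _
  have hnull : ∀ a : ℝ, μ {a} = 0 := by
    intro a
    rw [hμ, Measure.finsetSum_apply]
    refine Finset.sum_eq_zero fun i _ => ?_
    have : Real.toNNReal (v i ^ 2) ≠ 0 := by
      have := hv i
      simp only [ne_eq, Real.toNNReal_eq_zero, not_le]
      positivity
    have := nullSingletonClass_gaussianReal (μ := m i) this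
    rw [Measure.smul_apply, measure_singleton, smul_zero]
  have hmeas : ∀ Y : Fin N → ℝ, Measurable (fun ξ : ℝ => ⨅ j, (ξ - Y j) ^ 2) := by
    intro Y
    exact Measurable.iInf fun j => by fun_prop
  have hindm : ∀ j, Measurable ((aux_U x j \ aux_L x j).indicator (fun ξ => 2 * (x j - ξ))) :=
    fun j => Measurable.indicator (by fun_prop) ((aux_U_meas x j).diff (aux_L_meas x j))
  have key := hasFDerivAt_integral_of_dominated_loc_of_lip (μ := μ) (𝕜 := ℝ)
    (F := fun (Y : Fin N → ℝ) ξ => ⨅ j, (ξ - Y j) ^ 2) (F' := aux_F' x) (x₀ := x)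
    (s := Metric.ball x 1) (bound := fun ξ => 2 * (|ξ| + (‖x‖ + 1)))
    (Metric.ball_mem_nhds x one_pos)
    (Filter.Eventually.of_forall fun Y => (hmeas Y).aestronglyMeasurable)
    ?_ ?_ ?_ ?_ ?_
  · refine key.2.congr_fderiv ?_
    unfold aux_F'
    have hI : ∀ i j, Integrable ((aux_U x j \ aux_L x j).indicator (fun ξ => 2 * (x j - ξ)))
        (gaussianReal (m i) (Real.toNNReal (v i ^ 2))) := fun i j =>
      (((integrable_const _).sub (aux_int_id _ _)).const_mul 2).indicator
        ((aux_U_meas x j).diff (aux_L_meas x j))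
    rw [integral_finsetSum]
    · refine Finset.sum_congr rfl fun j _ => ?_
      rw [integral_smul_const, hval _ (fun i => hI i j)]
      congr 1
      rw [Finset.mul_sum]
      refine Finset.sum_congr rfl fun i _ => ?_
      rw [integral_indicator ((aux_U_meas x j).diff (aux_L_meas x j)), integral_const_mul,
        aux_cell_integral x hx j (m i) (v i) (hv i)]
      ring
    · intro j _
      exact (hint _ (fun i => hI i j)).smul_const _
  · have hb : Integrable (fun ξ : ℝ => (ξ - x ⟨0, hN⟩) ^ 2) μ := by
      have := (hsq.sub (hid.const_mul (2 * x ⟨0, hN⟩))).add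
        (integrable_const (μ := μ) (x ⟨0, hN⟩ ^ 2))
      refine this.congr (Filter.Eventually.of_forall fun ξ => ?_)
      simp only [Pi.add_apply, Pi.sub_apply]
      ring
    refine hb.mono' (hmeas x).aestronglyMeasurable (Filter.Eventually.of_forall fun ξ => ?_)
    rw [Real.norm_of_nonneg (Real.iInf_nonneg fun j => sq_nonneg _)]
    exact ciInf_le (Set.finite_range (fun j => (ξ - x j) ^ 2)).bddBelow _
  · unfold aux_F'
    refine Finset.aestronglyMeasurable_fun_sum _ fun j _ => ?_
    exact (hindm j).aestronglyMeasurable.smul_const _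
  · refine Filter.Eventually.of_forall fun ξ => ?_
    refine LipschitzOnWith.of_dist_le_mul fun Y hY Z hZ => ?_
    have hY' : ∀ W ∈ Metric.ball x 1, ∀ j, |W j| ≤ ‖x‖ + 1 := by
      intro W hW j
      have h1 : ‖W‖ ≤ ‖x‖ + 1 := by
        have := norm_sub_norm_le W x
        rw [mem_ball_iff_norm] at hW
        linarith
      exact (norm_le_pi_norm W j).trans h1
    rw [Real.dist_eq]
    apply aux_lip hN
    intro j
    have h1 := hY' Y hY j
    have h2 := hY' Z hZ j
    have h3 : |Z j - Y j| ≤ dist Y Z := by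
      rw [dist_comm, dist_eq_norm]
      exact norm_le_pi_norm (Z - Y) j
    have h4 : (ξ - Y j) ^ 2 - (ξ - Z j) ^ 2 = (2 * ξ - Y j - Z j) * (Z j - Y j) := by ring
    rw [h4, abs_mul, Real.coe_nnabs]
    refine mul_le_mul ?_ h3 (abs_nonneg _) (abs_nonneg _)
    refine le_trans ?_ (le_abs_self _)
    rw [abs_le] at h1 h2 ⊢
    have := le_abs_self ξ
    have := neg_abs_le ξ
    constructor <;> linarith
  · exact ((hid.abs).add (integrable_const _)).const_mul 2
  · have hae : ∀ᵐ ξ ∂μ, ∀ j k : Fin N, j ≠ k → ξ ≠ (x j + x k) / 2 := by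
      rw [ae_all_iff]; intro j
      rw [ae_all_iff]; intro k
      have : ∀ᵐ ξ ∂μ, ξ ≠ (x j + x k) / 2 := by
        rw [ae_iff]
        simpa using hnull ((x j + x k) / 2)
      exact this.mono fun ξ h _ => h
    filter_upwards [hae] with ξ hξ
    exact aux_diff hN x hx ξ hξ

end
end
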